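/- arXiv:2009.10851 — 2 statements merged into one kernel-verified Lean document; each statement's English description precedes it below -/
import Mathlib

section
/- Let p be an odd prime, a ∈ F_{p^5} nonzero, r ≥ 1, f(x) = x^r(x^{p−1} + a), and ℓ = p^4 + p^3 + p^2 + p + 1. Then f permutes F_{p^5} if and only if (−a)^ℓ ≠ 1, gcd(r, p−1) = 1, and the least nonnegative residue of r modulo ℓ lies in {1, p^3 + 1, p^4 + p^2 + 1, ℓ − p}. -/
lemma aux_sum_pow {F : Type*} [Field F] [Fintype F] (p : ℕ) [Fact p.Prime] [CharP F p]
    (n : ℕ) (hn : 0 < n) :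
    ∑ x : F, (WittVector.teichmuller p x) ^ n =
      if (Fintype.card F - 1) ∣ n then ((Fintype.card F - 1 : ℕ) : WittVector p F) else 0 := by
  classical
  have h0 : ∀ n, 0 < n → ∑ x : F, (WittVector.teichmuller p x) ^ n
      = ∑ x : Fˣ, (WittVector.teichmuller p (x : F)) ^ n := by
    intro n hn
    rw [← Finset.sum_erase (a := (0:F)) _ (by simp [WittVector.teichmuller_zero, hn.ne'])]
    symm
    refine Finset.sum_bij (fun x _ => (x : F)) ?_ ?_ ?_ ?_
    · intro x _; simp
    · intro x _ y _ h; exact Units.ext h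
    · intro x hx
      simp at hx
      exact ⟨Units.mk0 x hx, by simp, rfl⟩
    · intro x _; rfl
  rw [h0 n hn]
  split_ifs with h
  · obtain ⟨c, rfl⟩ := h
    have : ∀ x : Fˣ, (WittVector.teichmuller p (x : F)) ^ ((Fintype.card F - 1) * c) = 1 := by
      intro x
      rw [← map_pow, pow_mul, FiniteField.pow_card_sub_one_eq_one _ x.ne_zero, one_pow, map_one]
    simp [this, Fintype.card_units]
  · obtain ⟨g, hg⟩ := IsCyclic.exists_generator (α := Fˣ)
    have hgn : g ^ n ≠ 1 := by
      intro hh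
      apply h
      rw [← Fintype.card_units, ← Nat.card_eq_fintype_card, ← orderOf_eq_card_of_forall_mem_zpowers hg]
      exact orderOf_dvd_of_pow_eq_one hh
    have key : WittVector.teichmuller p ((g : F)) ^ n * ∑ x : Fˣ, (WittVector.teichmuller p (x : F)) ^ n
        = ∑ x : Fˣ, (WittVector.teichmuller p (x : F)) ^ n := by
      rw [Finset.mul_sum]
      refine Fintype.sum_equiv (Equiv.mulLeft g) _ _ ?_
      intro x
      simp [mul_pow]
    have h2 : (WittVector.teichmuller p ((g : F)) ^ n - 1) * ∑ x : Fˣ, (WittVector.teichmuller p (x : F)) ^ n = 0 := by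
      rw [sub_mul, key]; ring
    rcases mul_eq_zero.mp h2 with h3 | h3
    · exfalso
      apply hgn
      have h4 := congrArg (fun z => z.coeff 0) (sub_eq_zero.mp h3)
      simp only [← map_pow, WittVector.teichmuller_coeff_zero, WittVector.one_coeff_zero] at h4
      exact Units.ext (by simpa using h4)
    · exact h3

lemma aux_p_dvd {F : Type*} [Field F] [Fintype F] (p : ℕ) [Fact p.Prime] [CharP F p]
    (z : WittVector p F) (hz : WittVector.constantCoeff z = 0) : (p : WittVector p F) ∣ z := by
  replace hz : z.coeff 0 = 0 := hz
  by_cases h : z = 0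
  · simp [h]
  · obtain ⟨m, b, hb, rfl⟩ := WittVector.exists_eq_pow_p_mul z h
    rcases Nat.eq_zero_or_pos m with rfl | hm
    · simp at hz; exact absurd hz hb
    · exact Dvd.dvd.mul_right (dvd_pow_self _ hm.ne') _

lemma aux_nat_dvd {F : Type*} [Field F] [Fintype F] (p : ℕ) [Fact p.Prime] [CharP F p]
    (k c : ℕ) (h : (p : WittVector p F) ^ k ∣ (c : WittVector p F)) : p ^ k ∣ c := by
  induction k generalizing c with
  | zero => simp
  | succ k ih =>
    have h1 : p ∣ c := by
      obtain ⟨d, hd⟩ := h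
      have := congrArg (WittVector.constantCoeff (p := p) (R := F)) hd
      rw [map_mul, map_pow, map_natCast, map_natCast, CharP.cast_eq_zero F p, zero_pow (by omega),
        zero_mul] at this
      exact (CharP.cast_eq_zero_iff F p c).mp this
    obtain ⟨d, rfl⟩ := h1
    rw [pow_succ']
    apply mul_dvd_mul_left
    apply ih
    rw [pow_succ', Nat.cast_mul] at h
    exact (mul_dvd_mul_iff_left (WittVector.p_nonzero p F)).mp h

lemma key {F : Type*} [Field F] [Fintype F] (p : ℕ) [Fact p.Prime] [CharP F p]
    (hF : Fintype.card F = p ^ 5) (a : F) (ha : a ≠ 0) (r : ℕ) (hr : 1 ≤ r) (ℓ : ℕ)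
    (hℓ : ℓ = p ^ 4 + p ^ 3 + p ^ 2 + p + 1)
    (hbij : Function.Bijective (fun x : F => x ^ r * (x ^ (p - 1) + a)))
    (k e m E j : ℕ) (hE : E = p ^ k * e) (hEm : E = (p - 1) * m) (hE0 : 0 < E) (hEl : E < ℓ)
    (hj : j ≤ E) (hjl : ℓ ∣ r * m + j) : p ^ (k + 1) ∣ E.choose j := by
  have hp := (Fact.out : p.Prime)
  have hp2 := hp.two_le
  have hcard : Fintype.card F - 1 = (p - 1) * ℓ := by
    rw [hF, hℓ]
    obtain ⟨u, rfl⟩ : ∃ u, p = u + 1 := ⟨p - 1, by omega⟩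
    simp only [Nat.add_sub_cancel]
    have : (u + 1) ^ 5 = u * ((u + 1) ^ 4 + (u + 1) ^ 3 + (u + 1) ^ 2 + (u + 1) + 1) + 1 := by ring
    omega
  set τ := WittVector.teichmuller p (R := F) with hτ
  have hS1 : ∑ x : F, (τ (x ^ r * (x ^ (p - 1) + a))) ^ E = 0 := by
    rw [hbij.sum_comp (fun y : F => (τ y) ^ E), aux_sum_pow p E hE0, if_neg]
    intro hd
    rw [hcard] at hd
    have := Nat.le_of_dvd hE0 hd
    have : ℓ ≤ (p - 1) * ℓ := Nat.le_mul_of_pos_left _ (by omega)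
    omega
  have hS2 : (p : WittVector p F) ^ (k + 1) ∣
      ∑ x : F, (τ x ^ r * (τ x ^ (p - 1) + τ a)) ^ E := by
    rw [← sub_zero (∑ x : F, (τ x ^ r * (τ x ^ (p - 1) + τ a)) ^ E), ← hS1,
      ← Finset.sum_sub_distrib]
    apply Finset.dvd_sum
    intro x _
    rw [hE, pow_mul, pow_mul]
    refine dvd_trans ?_ (sub_dvd_pow_sub_pow _ _ e)
    apply dvd_sub_pow_of_dvd_sub
    apply aux_p_dvd
    have hc : ∀ y, WittVector.constantCoeff (τ y) = y := fun y => WittVector.teichmuller_coeff_zero p y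
    rw [map_sub, hc (x ^ r * (x ^ (p - 1) + a))]
    simp only [map_mul, map_pow, map_add, hc, sub_self]
  have hS3 : ∑ x : F, (τ x ^ r * (τ x ^ (p - 1) + τ a)) ^ E =
      ((E.choose j : ℕ) : WittVector p F) * τ a ^ (E - j) * ((Fintype.card F - 1 : ℕ) : WittVector p F) := by
    have : ∀ x : F, (τ x ^ r * (τ x ^ (p - 1) + τ a)) ^ E =
        ∑ i ∈ Finset.range (E + 1), (E.choose i : WittVector p F) * τ a ^ (E - i) *
          τ x ^ (r * E + (p - 1) * i) := by
      intro x
      rw [mul_pow, add_pow, Finset.mul_sum]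
      apply Finset.sum_congr rfl
      intro i _
      ring
    simp_rw [this]
    rw [Finset.sum_comm]
    simp_rw [← Finset.mul_sum]
    rw [Finset.sum_eq_single j]
    · rw [aux_sum_pow p _ (by positivity), if_pos]
      rw [hcard, hEm]
      have : r * ((p - 1) * m) + (p - 1) * j = (p - 1) * (r * m + j) := by ring
      rw [this]
      exact mul_dvd_mul_left _ hjl
    · intro i hi hij
      rw [aux_sum_pow p _ (by positivity), if_neg, mul_zero]
      rw [hcard, hEm]
      have : r * ((p - 1) * m) + (p - 1) * i = (p - 1) * (r * m + i) := by ring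
      rw [this, Nat.mul_dvd_mul_iff_left (by omega)]
      intro hd
      apply hij
      have h1 : (r * m + i) ≡ (r * m + j) [MOD ℓ] :=
        ((Nat.modEq_zero_iff_dvd).mpr hd).trans ((Nat.modEq_zero_iff_dvd).mpr hjl).symm
      have h2 := Nat.ModEq.add_left_cancel' _ h1
      simp at hi
      exact Nat.ModEq.eq_of_lt_of_lt h2 (by omega) (by omega)
    · intro h; simp at h; omega
  rw [hS3] at hS2
  have u1 : IsUnit (τ a ^ (E - j)) := by
    apply IsUnit.pow
    exact (IsUnit.mk0 a ha).map τ
  have u2 : IsUnit ((Fintype.card F - 1 : ℕ) : WittVector p F) := by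
    apply WittVector.isUnit_of_coeff_zero_ne_zero
    change WittVector.constantCoeff (p := p) (R := F) _ ≠ 0
    rw [map_natCast]
    rw [Ne, CharP.cast_eq_zero_iff F p, hF]
    intro hd
    have h5 : p ∣ p ^ 5 := dvd_pow_self _ (by norm_num)
    have h6 := (Nat.dvd_sub h5 hd)
    have : p ^ 5 - (p ^ 5 - 1) = 1 := by have : 0 < p ^ 5 := by positivity
                                         omega
    rw [this] at h6
    exact hp.one_lt.ne' (Nat.dvd_one.mp h6)
  rw [u2.dvd_mul_right, u1.dvd_mul_right] at hS2
  exact aux_nat_dvd (F := F) p _ _ hS2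

lemma choose_L0 (p : ℕ) (hp : p.Prime) (t j : ℕ) (hj : j < p ^ t) :
    ¬ p ∣ (p ^ t - 1).choose j := by
  induction j with
  | zero => simp; exact hp.one_lt.ne'
  | succ j ih =>
    intro hd
    apply ih (by omega)
    have h1 : p ∣ (p ^ t).choose (j + 1) := hp.dvd_choose_pow (by omega) (by omega)
    have h2 : (p ^ t).choose (j + 1) = (p ^ t - 1).choose j + (p ^ t - 1).choose (j + 1) := by
      obtain ⟨u, hu⟩ : ∃ u, p ^ t = u + 1 := ⟨p ^ t - 1, by omega⟩
      rw [hu]; exact Nat.choose_succ_succ _ _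
    rw [h2] at h1
    exact (Nat.dvd_add_left hd).mp h1

lemma choose_L1 (p : ℕ) (hp : p.Prime) (j : ℕ) (hj : j < p ^ 3) :
    ¬ p ∣ (p ^ 4 - p).choose (p * j) := by
  have := Fact.mk hp
  have h1 : p ^ 4 - p = p * (p ^ 3 - 1) := by
    rw [Nat.mul_sub]; ring_nf
  have h := Choose.choose_modEq_choose_mod_mul_choose_div_nat (p := p) (n := p * (p ^ 3 - 1)) (k := p * j)
  rw [Nat.mul_mod_right, Nat.mul_mod_right, Nat.mul_div_cancel_left _ hp.pos,
    Nat.mul_div_cancel_left _ hp.pos, Nat.choose_self, one_mul] at h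
  rw [h1, h.dvd_iff dvd_rfl]
  exact choose_L0 p hp 3 j hj

lemma choose_L3 (p : ℕ) (hp : p.Prime) (n j : ℕ) (hn : n < p ^ 4) (hj : j ≤ n) :
    ¬ p ^ 4 ∣ n.choose j := by
  have := Fact.mk hp
  rw [padicValNat_dvd_iff_le (Nat.choose_pos hj).ne',
    padicValNat_choose hj (b := 4) (Nat.log_lt_of_lt_pow' (by norm_num) hn)]
  have := Finset.card_filter_le (Finset.Ico 1 4) (fun i => p ^ i ≤ j % p ^ i + (n - j) % p ^ i)
  simp at this
  omega

lemma choose_L2 (p : ℕ) (hp : p.Prime) (n j : ℕ) (hn : n < p ^ 4) (hj : j ≤ n)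
    (h1 : p ∣ n) (h2 : p ∣ j) : ¬ p ^ 3 ∣ n.choose j := by
  have := Fact.mk hp
  rw [padicValNat_dvd_iff_le (Nat.choose_pos hj).ne',
    padicValNat_choose hj (b := 4) (Nat.log_lt_of_lt_pow' (by norm_num) hn)]
  have : (Finset.filter (fun i => p ^ i ≤ j % p ^ i + (n - j) % p ^ i) (Finset.Ico 1 4)) ⊆ Finset.Ico 2 4 := by
    intro i hi
    simp only [Finset.mem_filter, Finset.mem_Ico] at hi ⊢
    refine ⟨?_, hi.1.2⟩
    by_contra hlt
    have : i = 1 := by omega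
    subst this
    have h3 : p ∣ n - j := Nat.dvd_sub h1 h2
    simp [Nat.mod_eq_zero_of_dvd h2, Nat.mod_eq_zero_of_dvd h3] at hi
    have := hp.pos
    omega
  have := Finset.card_le_card this
  simp at this
  omega

set_option maxHeartbeats 2000000 in
lemma arith (p : ℕ) (hp : p.Prime) (ℓ ρ : ℕ) (hp2 : 2 ≤ p)
    (hℓ : ℓ = p ^ 4 + p ^ 3 + p ^ 2 + p + 1) (hρ : ρ < ℓ)
    (H : ∀ k m j : ℕ, k ≤ 3 → p ^ 4 = p ^ k + (p - 1) * m → j + p ^ k ≤ p ^ 4 →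
      (ℓ : ℤ) ∣ ρ * m + j → p ^ (k + 1) ∣ (p ^ 4 - p ^ k).choose j) :
    ρ = 1 ∨ ρ = p ^ 3 + 1 ∨ ρ = p ^ 4 + p ^ 2 + 1 ∨ ρ = ℓ - p := by
  obtain ⟨P, rfl⟩ : ∃ P, p = P + 2 := ⟨p - 2, by omega⟩
  set p := P + 2 with hpP
  have hp1 : (p - 1 : ℕ) = P + 1 := by omega
  have hPz : (P : ℤ) = p - 2 := by push_cast [hpP]; ring
  have hℓz : (ℓ : ℤ) = p ^ 4 + p ^ 3 + p ^ 2 + p + 1 := by rw [hℓ]; push_cast; ring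
  have hpz : (2 : ℤ) ≤ p := by exact_mod_cast hp2
  -- step 0
  obtain ⟨i, hi, hρi⟩ : ∃ i : ℕ, i ≤ p ^ 3 + p ^ 2 + p ∧ ρ = 1 + p * i := by
    have hq := Nat.div_add_mod (p ^ 4 * ρ) ℓ
    have hlt := Nat.mod_lt (p ^ 4 * ρ) (show 0 < ℓ by omega)
    set j0 := (p ^ 4 * ρ) % ℓ
    set q := (p ^ 4 * ρ) / ℓ
    have hqz : (ℓ : ℤ) * q + j0 = p ^ 4 * ρ := by exact_mod_cast hq
    by_cases hc : j0 < p ^ 4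
    · exfalso
      refine choose_L0 p hp 4 j0 hc ?_
      have := H 0 (p ^ 3 + p ^ 2 + p + 1) j0 (by norm_num) (by rw [hp1, hpP]; ring) (by simp; omega)
        ⟨ρ - q, by push_cast; linear_combination hqz - (ρ : ℤ) * hℓz⟩
      simpa using this
    · refine ⟨j0 - p ^ 4, by omega, ?_⟩
      obtain ⟨i, hi⟩ : ∃ i, j0 = p ^ 4 + i := ⟨j0 - p ^ 4, by omega⟩
      rw [hi, Nat.add_sub_cancel_left]
      have hile : i ≤ p ^ 3 + p ^ 2 + p := by omega
      have hb : 1 + p * i < ℓ := by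
        have : p * i ≤ p * (p ^ 3 + p ^ 2 + p) := Nat.mul_le_mul_left _ hile
        have h2 : p * (p ^ 3 + p ^ 2 + p) = p ^ 4 + p ^ 3 + p ^ 2 := by ring
        omega
      have hmod : (ℓ : ℤ) ∣ ((1 + p * i : ℕ) : ℤ) - ρ := by
        rw [hi] at hqz
        refine ⟨ρ * (p - 1) - p * q - (p - 1), ?_⟩
        push_cast at hqz ⊢
        linear_combination (p : ℤ) * hqz + ((p - 1 : ℤ) - ρ * (p - 1)) * hℓz
      exact Nat.ModEq.eq_of_lt_of_lt ((Nat.modEq_iff_dvd).mpr hmod) hρ hb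
  -- step 3
  obtain ⟨s, hs, hρs⟩ : ∃ s : ℕ, s ≤ p ^ 2 + p + 1 ∧ ρ = 1 + p ^ 2 * s := by
    have hd := Nat.div_add_mod i p
    have hv := Nat.mod_lt i (show 0 < p by omega)
    set u := i / p
    set v := i % p
    by_cases hv0 : v = 0
    · refine ⟨u, ?_, ?_⟩
      · rw [hv0, add_zero] at hd
        have : p * u ≤ p * (p ^ 2 + p + 1) := by rw [hd]; linarith [hi, show p * (p ^ 2 + p + 1) = p ^ 3 + p ^ 2 + p by ring]
        exact Nat.le_of_mul_le_mul_left this (by omega)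
      · rw [hρi, ← hd, hv0]; ring
    · exfalso
      have hu : u ≤ p ^ 2 + p := by
        by_contra hu
        have : p * (p ^ 2 + p + 1) ≤ p * u := Nat.mul_le_mul_left _ (by omega)
        have h3 : p * (p ^ 2 + p + 1) = p ^ 3 + p ^ 2 + p := by ring
        omega
      have huz : (u : ℤ) ≤ p ^ 2 + p := by exact_mod_cast hu
      have hvz : (v : ℤ) + 1 ≤ p := by exact_mod_cast hv
      have hv1 : (1 : ℤ) ≤ v := by exact_mod_cast (Nat.one_le_iff_ne_zero.mpr hv0)
      have hj0 : (0 : ℤ) ≤ v * (1 + p + p ^ 2) + (v - 1) * p ^ 3 - u := by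
        have : (0 : ℤ) ≤ (v - 1) * (1 + p + p ^ 2 + p ^ 3) := mul_nonneg (by linarith) (by positivity)
        nlinarith
      obtain ⟨j, hj⟩ := Int.eq_ofNat_of_zero_le hj0
      have hjle : j + p ^ 3 ≤ p ^ 4 := by
        have : (0 : ℤ) ≤ (p - 1 - v) * (1 + p + p ^ 2 + p ^ 3) := mul_nonneg (by linarith) (by positivity)
        have hu0 : (0 : ℤ) ≤ u := by positivity
        have : (j : ℤ) + p ^ 3 ≤ p ^ 4 := by rw [← hj]; nlinarith
        exact_mod_cast this
      have hdz : (p : ℤ) * u + v = i := by exact_mod_cast hd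
      have hρz : (ρ : ℤ) = 1 + p * (p * u + v) := by rw [hρi, hdz]; push_cast; ring
      refine choose_L3 p hp (p ^ 4 - p ^ 3) j ?_ (by omega) (H 3 (p ^ 3) j le_rfl ?_ hjle ?_)
      · have : 0 < p ^ 3 := by positivity
        have : 0 < p ^ 4 := by positivity
        omega
      · rw [hp1, hpP]; ring
      · refine ⟨u * (p - 1) + v, ?_⟩
        rw [← hj, hρz, hℓz]; push_cast; ring
  have hsz : (s : ℤ) ≤ p ^ 2 + p + 1 := by exact_mod_cast hs
  have hρz : (ρ : ℤ) = 1 + p ^ 2 * s := by rw [hρs]; push_cast; ring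
  -- step 1
  have h1 : ¬ (p < s ∧ s ≤ p ^ 2) := by
    rintro ⟨ha, hb⟩
    have haz : (p : ℤ) + 1 ≤ s := by exact_mod_cast ha
    have hbz : (s : ℤ) ≤ p ^ 2 := by exact_mod_cast hb
    have hj0 : (0 : ℤ) ≤ s * (1 + p) - 1 - p - p ^ 2 := by nlinarith
    obtain ⟨j, hj⟩ := Int.eq_ofNat_of_zero_le hj0
    have hjlt : j < p ^ 3 := by
      have : (j : ℤ) < p ^ 3 := by rw [← hj]; nlinarith
      exact_mod_cast this
    have hm : p ^ 4 = p ^ 1 + (p - 1) * (p + p ^ 2 + p ^ 3) := by rw [hp1, hpP]; ring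
    have hle : p * j + p ^ 1 ≤ p ^ 4 := by
      have h3 := Nat.mul_le_mul_left p (Nat.succ_le_of_lt hjlt)
      rw [show p * (j.succ) = p * j + p ^ 1 by rw [Nat.succ_eq_add_one]; ring,
        show p * p ^ 3 = p ^ 4 by ring] at h3
      exact h3
    have := H 1 (p + p ^ 2 + p ^ 3) (p * j) (by norm_num) hm hle
      ⟨s * p, by push_cast; rw [← hj, hρz, hℓz]; ring⟩
    rw [pow_one] at this
    exact choose_L1 p hp j hjlt (dvd_trans (dvd_pow_self p (by norm_num)) this)
  -- step 2
  have hm2 : p ^ 4 = p ^ 2 + (p - 1) * (p ^ 2 + p ^ 3) := by rw [hp1, hpP]; ring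
  have hn2 : p ^ 4 - p ^ 2 < p ^ 4 := by
    have : 0 < p ^ 2 := by positivity
    have : 0 < p ^ 4 := by positivity
    omega
  have hd2 : p ∣ p ^ 4 - p ^ 2 := Nat.dvd_sub (dvd_pow_self p (by norm_num)) (dvd_pow_self p (by norm_num))
  have key2 : ∀ w : ℕ, 1 ≤ w → w < p → (s = w ∨ s + w = p ^ 2 + p + 1) → False := by
    intro w hw1 hwp hsw
    have hw1z : (1 : ℤ) ≤ w := by exact_mod_cast hw1
    have hwpz : (w : ℤ) + 1 ≤ p := by exact_mod_cast hwp
    have hj0 : (0 : ℤ) ≤ (w - 1) * (p ^ 2 + p) + w := by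
      have : (0 : ℤ) ≤ (w - 1) * (p ^ 2 + p) := mul_nonneg (by linarith) (by positivity)
      linarith
    obtain ⟨j, hj⟩ := Int.eq_ofNat_of_zero_le hj0
    have hle : p * j + p ^ 2 ≤ p ^ 4 := by
      have h0 : (0 : ℤ) ≤ (p - 1 - w) * (p ^ 2 + p + 1) := mul_nonneg (by linarith) (by positivity)
      have h1 : (j : ℤ) + p ≤ p ^ 3 := by rw [← hj]; nlinarith
      have h2 : j + p ≤ p ^ 3 := by exact_mod_cast h1
      have h3 := Nat.mul_le_mul_left p h2
      rw [show p * (j + p) = p * j + p ^ 2 by ring, show p * p ^ 3 = p ^ 4 by ring] at h3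
      exact h3
    rcases hsw with h | h
    · refine choose_L2 p hp _ (p * j) hn2 (by omega) hd2 (dvd_mul_right _ _)
        (H 2 (p ^ 2 + p ^ 3) (p * j) (by norm_num) hm2 hle ⟨w * p, ?_⟩)
      push_cast; rw [← hj, hρz, hℓz, h]; ring
    · refine choose_L2 p hp _ (p ^ 4 - p ^ 2 - p * j) hn2 (by omega) hd2
        (Nat.dvd_sub hd2 (dvd_mul_right _ _))
        (H 2 (p ^ 2 + p ^ 3) (p ^ 4 - p ^ 2 - p * j) (by norm_num) hm2 (by omega)
          ⟨p ^ 2 + p ^ 3 - w * p, ?_⟩)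
      have hsz : (s : ℤ) = p ^ 2 + p + 1 - w := by
        have : (s : ℤ) + w = p ^ 2 + p + 1 := by exact_mod_cast h
        linarith
      rw [Nat.cast_sub (by omega), Nat.cast_sub (by omega)]
      push_cast; rw [← hj, hρz, hℓz, hsz]; ring
  have hfin : s = 0 ∨ s = p ∨ s = p ^ 2 + 1 ∨ s = p ^ 2 + p + 1 := by
    by_contra hcon
    push Not at hcon
    obtain ⟨c1, c2, c3, c4⟩ := hcon
    by_cases hsp : s < p
    · exact key2 s (by omega) hsp (Or.inl rfl)
    · exact key2 (p ^ 2 + p + 1 - s) (by omega) (by omega) (Or.inr (by omega))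
  rcases hfin with h | h | h | h
  · left; rw [hρs, h]; ring
  · right; left; rw [hρs, h]; ring
  · right; right; left; rw [hρs, h]; ring
  · right; right; right
    have : ℓ = ρ + p := by rw [hρs, h, hℓ]; ring
    omega

lemma lin_inj {F : Type*} [Field F] [Fintype F] (p : ℕ) [Fact p.Prime] [CharP F p]
    (ℓ : ℕ) (hcard : Fintype.card F - 1 = (p - 1) * ℓ) (a : F)
    (hna : (-a) ^ ℓ ≠ 1) (k : ℕ) (_hk : 0 < k) (w w' c : F) (hc : c ^ p = c)
    (h : w ^ p ^ k + a * w = c * (w' ^ p ^ k + a * w')) : w = c * w' := by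
  have hck : ∀ k, c ^ p ^ k = c := by
    intro k
    induction k with
    | zero => simp
    | succ k ih => rw [pow_succ, pow_mul, ih, hc]
  by_contra hne
  have hz : w - c * w' ≠ 0 := sub_ne_zero.mpr hne
  have h1 : (w - c * w') ^ p ^ k = -a * (w - c * w') := by
    rw [sub_pow_char_pow, mul_pow, hck]
    linear_combination h
  have hpk : p ^ k = (p ^ k - 1) + 1 := by
    have : 0 < p ^ k := pow_pos (Fact.out : p.Prime).pos k
    omega
  rw [hpk, pow_succ] at h1
  have h2 := mul_right_cancel₀ hz h1
  apply hna
  obtain ⟨B, hB⟩ : (p - 1) ∣ p ^ k - 1 := by simpa using Nat.sub_dvd_pow_sub_pow p 1 k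
  rw [← h2, hB, ← pow_mul, show (p - 1) * B * ℓ = ((p - 1) * ℓ) * B by ring, ← hcard, pow_mul,
    FiniteField.pow_card_sub_one_eq_one _ hz, one_pow]

lemma lin_inj' {F : Type*} [Field F] [Fintype F] (p : ℕ) [Fact p.Prime] [CharP F p]
    (ℓ : ℕ) (hcard : Fintype.card F - 1 = (p - 1) * ℓ) (a : F) (ha : a ≠ 0)
    (hna : (-a) ^ ℓ ≠ 1) (k : ℕ) (_hk : 0 < k) (w w' c : F) (hc : c ^ p = c)
    (h : w + a * w ^ p ^ k = c * (w' + a * w' ^ p ^ k)) : w = c * w' := by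
  refine lin_inj p ℓ hcard a⁻¹ ?_ k _hk w w' c hc ?_
  · rw [← inv_neg, inv_pow]
    intro h; exact hna (inv_eq_one.mp h)
  · field_simp
    linear_combination h

lemma proj3 {F : Type*} [Field F] [Fintype F] (p : ℕ) (hp2 : 2 ≤ p)
    (hF : Fintype.card F = p ^ 5) (ℓ : ℕ) (hodd : Odd ℓ)
    (hcard : Fintype.card F - 1 = (p - 1) * ℓ) (x c : F) (hx : x ≠ 0)
    (hc : c ^ (p - 1) = 1) (h : x ^ (p ^ 3 + 1) = c) : x ^ (p - 1) = 1 := by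
  set s := x ^ (p - 1) with hs
  have hs0 : s ≠ 0 := pow_ne_zero _ hx
  have h1 : s ^ (p ^ 3 + 1) = 1 := by
    rw [hs, ← pow_mul, mul_comm, pow_mul, h, hc]
  have h2 : s ^ ℓ = 1 := by
    rw [hs, ← pow_mul, ← hcard, FiniteField.pow_card_sub_one_eq_one _ hx]
  have h3 : s ^ p ^ 5 = s := by rw [← hF]; exact FiniteField.pow_card s
  have h4 : s ^ p ^ 3 = s⁻¹ := by
    rw [pow_succ] at h1
    exact eq_inv_of_mul_eq_one_left h1
  have h5 : s ^ p = s := by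
    have e1 : s ^ p ^ 6 = s := by
      rw [show p ^ 6 = p ^ 3 * p ^ 3 by ring, pow_mul, h4, inv_pow, h4, inv_inv]
    have e2 : s ^ p ^ 6 = s ^ p := by
      rw [show p ^ 6 = p ^ 5 * p by ring, pow_mul, h3]
    rw [← e2, e1]
  have h6 : s ^ p ^ 3 = s := by
    rw [show p ^ 3 = p * p * p by ring, pow_mul, pow_mul, h5, h5, h5]
  have h7 : s ^ 2 = 1 := by
    rw [h6] at h4
    rw [pow_two]; nth_rewrite 2 [h4]; exact mul_inv_cancel₀ hs0
  obtain ⟨t, ht⟩ := hodd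
  rw [ht, pow_succ, pow_mul, h7, one_pow, one_mul] at h2
  exact h2

lemma suff {F : Type*} [Field F] [Fintype F] (p : ℕ) [Fact p.Prime] [CharP F p] (hpodd : Odd p)
    (hF : Fintype.card F = p ^ 5) (a : F) (ha : a ≠ 0) (r : ℕ) (hr : 1 ≤ r) (ℓ : ℕ)
    (hℓ : ℓ = p ^ 4 + p ^ 3 + p ^ 2 + p + 1)
    (hcard : Fintype.card F - 1 = (p - 1) * ℓ) (hna : (-a) ^ ℓ ≠ 1)
    (hgcd : Nat.gcd r (p - 1) = 1)
    (hρ : r % ℓ = 1 ∨ r % ℓ = p ^ 3 + 1 ∨ r % ℓ = p ^ 4 + p ^ 2 + 1 ∨ r % ℓ = ℓ - p) :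
    Function.Bijective (fun x : F => x ^ r * (x ^ (p - 1) + a)) := by
  rw [← Finite.injective_iff_bijective]
  have hp := (Fact.out : p.Prime)
  have hp2 := hp.two_le
  have hp1 : p - 1 + 1 = p := by omega
  have hlodd : Odd ℓ := by
    rw [hℓ]
    have := hpodd.pow (n := 4)
    have := hpodd.pow (n := 3)
    have := hpodd.pow (n := 2)
    grind
  have hx5 : ∀ x : F, x ^ p ^ 5 = x := fun x => by rw [← hF]; exact FiniteField.pow_card x
  have hnz : ∀ x : F, x ≠ 0 → x ^ r * (x ^ (p - 1) + a) ≠ 0 := by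
    intro x hx h
    rcases mul_eq_zero.mp h with h | h
    · exact hx (pow_eq_zero_iff (by omega) |>.mp h)
    · apply hna
      rw [← eq_neg_iff_add_eq_zero.mpr h, ← pow_mul, ← hcard,
        FiniteField.pow_card_sub_one_eq_one _ hx]
  intro x y hxy
  simp only at hxy
  by_cases hx : x = 0
  · by_contra hne
    apply hnz y (fun h => hne (by rw [hx, h]))
    rw [← hxy, hx, zero_pow (by omega), zero_mul]
  have hy : y ≠ 0 := by
    intro hy
    apply hnz x hx
    rw [hxy, hy, zero_pow (by omega), zero_mul]
  have hNx : ∀ x : F, x ≠ 0 → (x ^ ℓ) ^ (p - 1) = 1 := by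
    intro x hx
    rw [← pow_mul, mul_comm, ← hcard, FiniteField.pow_card_sub_one_eq_one _ hx]
  -- it suffices that `x / y` is in the prime field
  suffices hproj : (x / y) ^ (p - 1) = 1 by
    have e1 : x ^ (p - 1) = y ^ (p - 1) := by
      rw [div_pow] at hproj
      exact (div_eq_one_iff_eq (pow_ne_zero _ hy)).mp hproj
    have e2 : y ^ (p - 1) + a ≠ 0 := fun h => hnz y hy (by rw [h, mul_zero])
    rw [e1] at hxy
    have e3 : (x / y) ^ r = 1 := by
      rw [div_pow, mul_right_cancel₀ e2 hxy, div_self (pow_ne_zero _ hy)]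
    have e4 := pow_gcd_eq_one.mpr ⟨e3, hproj⟩
    rw [hgcd, pow_one] at e4
    exact (div_eq_one_iff_eq hy).mp e4
  set ρ := r % ℓ with hρd
  set q := r / ℓ with hqd
  have hrq : r = ℓ * q + ρ := (Nat.div_add_mod r ℓ).symm
  have hxl : x ^ ℓ ≠ 0 := pow_ne_zero _ hx
  have hyl : y ^ ℓ ≠ 0 := pow_ne_zero _ hy
  set c : F := (y ^ ℓ) ^ q / (x ^ ℓ) ^ q with hcdef
  have hc1 : c ^ (p - 1) = 1 := by
    rw [hcdef, div_pow, ← pow_mul, mul_comm, pow_mul, hNx y hy, ← pow_mul (x ^ ℓ), mul_comm q, pow_mul, hNx x hx]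
    simp
  have hcp : c ^ p = c := by
    rw [← hp1, pow_succ, hc1, one_mul]
  have hmain : x ^ ρ * (x ^ (p - 1) + a) = c * (y ^ ρ * (y ^ (p - 1) + a)) := by
    rw [hrq, pow_add, pow_add, pow_mul, pow_mul] at hxy
    rw [hcdef]
    field_simp
    linear_combination hxy
  set dd : F := c * y ^ ℓ / x ^ ℓ with hdDef
  have hdOne : dd ^ (p - 1) = 1 := by
    rw [hdDef, div_pow, mul_pow, hc1, hNx y hy, hNx x hx]; simp
  have hdPow : dd ^ p = dd := by
    rw [← hp1, pow_succ, hdOne, one_mul]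
  have fin1 : ∀ d : F, d ^ (p - 1) = 1 → x = d * y → (x / y) ^ (p - 1) = 1 := by
    intro d hd h
    rw [h, mul_div_cancel_right₀ _ hy, hd]
  have hw3 : ∀ u : F, (u ^ (p ^ 3 + 1)) ^ p ^ 3 = u ^ (p ^ 3 + p) := by
    intro u
    rw [← pow_mul, show (p ^ 3 + 1) * p ^ 3 = p ^ 5 * p + p ^ 3 by ring, pow_add, pow_mul, hx5,
      add_comm, pow_add]
  rcases hρ with h | h | h | h
  · apply fin1 c hc1
    refine lin_inj p ℓ hcard a hna 1 one_pos x y c hcp ?_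
    rw [h] at hmain
    have e : ∀ z : F, z ^ p = z * z ^ (p - 1) := fun z => by
      rw [← pow_succ', hp1]
    rw [pow_one, e, e]
    linear_combination hmain
  · have e : ∀ z : F, z ^ ρ * (z ^ (p - 1) + a) =
        (z ^ (p ^ 3 + 1)) ^ p ^ 3 + a * z ^ (p ^ 3 + 1) := by
      intro z
      rw [hw3, h, mul_add, ← pow_add, show p ^ 3 + 1 + (p - 1) = p ^ 3 + p by omega]
      ring
    rw [e, e] at hmain
    have h1 := lin_inj p ℓ hcard a hna 3 (by norm_num) _ _ c hcp hmain
    refine proj3 p hp2 hF ℓ hlodd hcard (x / y) c (div_ne_zero hx hy) hc1 ?_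
    rw [div_pow, h1, mul_div_cancel_right₀ _ (pow_ne_zero _ hy)]
  · have e : ∀ z : F, z ≠ 0 → z ^ ρ * (z ^ (p - 1) + a) =
        z ^ ℓ * ((z⁻¹ ^ (p ^ 3 + 1)) + a * (z⁻¹ ^ (p ^ 3 + 1)) ^ p ^ 3) := by
      intro z hz
      have e1 : z ^ ℓ = z ^ ρ * z ^ (p ^ 3 + p) := by
        rw [← pow_add, h, hℓ]; congr 1; ring
      have e2 : z ^ (p ^ 3 + p) = z ^ (p - 1) * z ^ (p ^ 3 + 1) := by
        rw [← pow_add]; congr 1; omega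
      rw [hw3, e1, inv_pow, inv_pow, e2]
      field_simp
    rw [e x hx, e y hy] at hmain
    have h1 := lin_inj' p ℓ hcard a ha hna 3 (by norm_num) (x⁻¹ ^ (p ^ 3 + 1)) (y⁻¹ ^ (p ^ 3 + 1)) dd
      hdPow (by
        rw [hdDef]
        rw [eq_comm, div_mul_eq_mul_div, div_eq_iff hxl]
        linear_combination -hmain)
    have h2 := proj3 p hp2 hF ℓ hlodd hcard (x⁻¹ / y⁻¹) dd (div_ne_zero (inv_ne_zero hx) (inv_ne_zero hy)) hdOne
      (by rw [div_pow, h1, mul_div_cancel_right₀ _ (pow_ne_zero _ (inv_ne_zero hy))])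
    rw [← inv_div_inv, div_pow] 
    rw [div_pow] at h2
    rw [← inv_div, h2, inv_one]
  · have e : ∀ z : F, z ≠ 0 → z ^ ρ * (z ^ (p - 1) + a) =
        z ^ ℓ * (z⁻¹ + a * z⁻¹ ^ p ^ 1) := by
      intro z hz
      have e1 : z ^ ℓ = z ^ ρ * z ^ p := by
        rw [← pow_add, h]; congr 1; omega
      have e2 : z ^ p = z ^ (p - 1) * z := by
        rw [← pow_succ, hp1]
      rw [e1, inv_pow, pow_one, e2]
      field_simp
    rw [e x hx, e y hy] at hmain
    have h1 := lin_inj' p ℓ hcard a ha hna 1 (by norm_num) (x⁻¹) (y⁻¹) dd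
      hdPow (by
        rw [hdDef]
        rw [eq_comm, div_mul_eq_mul_div, div_eq_iff hxl]
        linear_combination -hmain)
    apply fin1 dd⁻¹ (by rw [inv_pow, hdOne, inv_one])
    rw [← inv_inv x, h1, mul_inv, inv_inv]

lemma nec1 {F : Type*} [Field F] [Fintype F] (p : ℕ) (hp2 : 2 ≤ p)
    (a : F) (ha : a ≠ 0) (r : ℕ) (hr : 1 ≤ r) (ℓ : ℕ) (hℓ : 0 < ℓ)
    (hcard : Fintype.card F - 1 = (p - 1) * ℓ)
    (hbij : Function.Bijective (fun x : F => x ^ r * (x ^ (p - 1) + a))) :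
    (-a) ^ ℓ ≠ 1 ∧ Nat.gcd r (p - 1) = 1 := by
  classical
  obtain ⟨g, hg⟩ := IsCyclic.exists_generator (α := Fˣ)
  have hord : orderOf g = (p - 1) * ℓ := by
    rw [orderOf_eq_card_of_forall_mem_zpowers hg, Nat.card_eq_fintype_card, Fintype.card_units, hcard]
  constructor
  · intro h
    obtain ⟨n, hn⟩ := (mem_powers_iff_mem_zpowers.mpr (hg (Units.mk0 (-a) (neg_ne_zero.mpr ha))))
    simp only at hn
    have h1 : g ^ (n * ℓ) = 1 := by
      rw [pow_mul, hn]
      ext; simpa using h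
    have h2 := orderOf_dvd_of_pow_eq_one h1
    rw [hord] at h2
    obtain ⟨c, hc⟩ := Nat.dvd_of_mul_dvd_mul_right hℓ h2
    have h3 : ((g ^ c : Fˣ) : F) ^ (p - 1) = -a := by
      rw [← Units.val_pow_eq_pow_val, ← pow_mul, mul_comm, ← hc, hn]; simp
    have := @hbij.1 ((g ^ c : Fˣ) : F) 0 (by
      simp only [h3]; rw [zero_pow (by omega : r ≠ 0)]; simp)
    exact (g ^ c).ne_zero this
  · set d := Nat.gcd r (p - 1) with hd
    obtain ⟨u, hu⟩ := Nat.gcd_dvd_left r (p - 1)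
    obtain ⟨v, hv⟩ := Nat.gcd_dvd_right r (p - 1)
    rw [← hd] at hu hv
    have hz : (g ^ (v * ℓ)) ^ d = 1 := by
      rw [← pow_mul, show v * ℓ * d = d * v * ℓ by ring, ← hv, ← hord, pow_orderOf_eq_one]
    have hz' : (((g ^ (v * ℓ) : Fˣ)) : F) ^ d = 1 := by
      rw [← Units.val_pow_eq_pow_val, hz, Units.val_one]
    have h1 := @hbij.1 ((g ^ (v * ℓ) : Fˣ) : F) 1 (by
      simp only
      rw [hv]
      nth_rewrite 1 [hu]
      rw [pow_mul, pow_mul _ d v, hz']; simp)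
    have h2 : g ^ (v * ℓ) = 1 := Units.ext h1
    have h3 := orderOf_dvd_of_pow_eq_one h2
    rw [hord] at h3
    have h4 := Nat.dvd_of_mul_dvd_mul_right hℓ h3
    rw [hv] at h4
    have hv0 : 0 < v := by
      rcases Nat.eq_zero_or_pos v with h | h
      · rw [h] at hv; omega
      · exact h
    have h5 : d * v ∣ 1 * v := by simpa using h4
    exact Nat.dvd_one.mp (Nat.dvd_of_mul_dvd_mul_right hv0 h5)

theorem stmt_17 (p : ℕ) (hp : p.Prime) (hpodd : Odd p)
    {F : Type*} [Field F] [Fintype F] (hF : Fintype.card F = p ^ 5)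
    (a : F) (ha : a ≠ 0) (r : ℕ) (hr : 1 ≤ r)
    (ℓ : ℕ) (hℓ : ℓ = p ^ 4 + p ^ 3 + p ^ 2 + p + 1) :
    Function.Bijective (fun x : F => x ^ r * (x ^ (p - 1) + a)) ↔
      ((-a) ^ ℓ ≠ 1 ∧ Nat.gcd r (p - 1) = 1 ∧
        (r % ℓ = 1 ∨ r % ℓ = p ^ 3 + 1 ∨ r % ℓ = p ^ 4 + p ^ 2 + 1 ∨ r % ℓ = ℓ - p)) := by
  have hfact : Fact p.Prime := ⟨hp⟩
  have hchar : CharP F p := by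
    obtain ⟨p', hp'⟩ := CharP.exists F
    obtain ⟨n, hprime, hn⟩ := FiniteField.card F p'
    have h1 : p ∣ p' ^ (n : ℕ) := by
      rw [← hn, hF]; exact dvd_pow_self p (by norm_num)
    have h2 : p = p' := (Nat.prime_dvd_prime_iff_eq hp hprime).mp (hp.dvd_of_dvd_pow h1)
    rw [h2]; exact hp'
  have hp2 := hp.two_le
  have hℓ0 : 0 < ℓ := by omega
  have hcard : Fintype.card F - 1 = (p - 1) * ℓ := by
    rw [hF, hℓ]
    obtain ⟨u, rfl⟩ : ∃ u, p = u + 1 := ⟨p - 1, by omega⟩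
    simp only [Nat.add_sub_cancel]
    have : (u + 1) ^ 5 = u * ((u + 1) ^ 4 + (u + 1) ^ 3 + (u + 1) ^ 2 + (u + 1) + 1) + 1 := by ring
    omega
  constructor
  · intro hbij
    obtain ⟨h1, h2⟩ := nec1 p hp2 a ha r hr ℓ hℓ0 hcard hbij
    refine ⟨h1, h2, ?_⟩
    refine arith p hp ℓ (r % ℓ) hp2 hℓ (Nat.mod_lt _ hℓ0) ?_
    intro k m j hk hm hj hd
    have hkk : p ^ 4 = p ^ k * p ^ (4 - k) := by rw [← pow_add]; congr 1; omega
    have hlt : p ^ k < p ^ 4 := Nat.pow_lt_pow_right hp.one_lt (by omega)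
    refine key p hF a ha r hr ℓ hℓ hbij k (p ^ (4 - k) - 1) m (p ^ 4 - p ^ k) j
      (by rw [hkk, Nat.mul_sub, mul_one]) (by omega) (by omega) (by omega) (by omega) ?_
    have h3 : (r % ℓ) * m + j ≡ r * m + j [MOD ℓ] :=
      ((Nat.mod_modEq r ℓ).mul_right m).add_right j
    exact (h3.dvd_iff dvd_rfl).mp (by exact_mod_cast hd)
  · rintro ⟨h1, h2, h3⟩
    exact suff p hpodd hF a ha r hr ℓ hℓ hcard h1 h2 h3
end

section
/- Let p be an odd prime, a ∈ F_{p^6} nonzero, r ≥ 1, f(x) = x^r(x^{p−1} + a), and ℓ = p^5 + p^4 + p^3 + p^2 + p + 1. Then f permutes F_{p^6} if and only if (−a)^ℓ ≠ 1, gcd(r, p−1) = 1, and the least nonnegative residue of r modulo ℓ lies in {1, ℓ − p}. -/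
open Finset

lemma aux_lucas {p K J a b : ℕ} (hp : p.Prime) (h : ¬ p ∣ Nat.choose K J) (hab : a ≤ b) (hb : b < p) :
    ¬ p ∣ Nat.choose (b + p * K) (a + p * J) := by
  haveI := Fact.mk hp
  have h1 := Choose.choose_modEq_choose_mod_mul_choose_div_nat (n := b + p * K) (k := a + p * J) (p := p)
  have ha : a < p := lt_of_le_of_lt hab hb
  have hp0 := hp.pos
  rw [Nat.add_mul_mod_self_left, Nat.add_mul_mod_self_left, Nat.mod_eq_of_lt hb, Nat.mod_eq_of_lt ha,
    Nat.add_mul_div_left _ _ hp0, Nat.add_mul_div_left _ _ hp0, Nat.div_eq_of_lt hb,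
    Nat.div_eq_of_lt ha, zero_add, zero_add] at h1
  intro h2
  have h3 : p ∣ Nat.choose b a * Nat.choose K J := (h1.dvd_iff dvd_rfl).1 h2
  rcases hp.dvd_mul.1 h3 with h4 | h4
  · have h5 : p ∣ b.factorial := by
      rw [← Nat.choose_mul_factorial_mul_factorial hab, mul_assoc]
      exact h4.mul_right _
    have := (hp.dvd_factorial).1 h5
    omega
  · exact h h4

lemma aux_lucas5 {p k0 k1 k2 k3 k4 j0 j1 j2 j3 j4 : ℕ} (hp : p.Prime)
    (h0 : j0 ≤ k0) (h1 : j1 ≤ k1) (h2 : j2 ≤ k2) (h3 : j3 ≤ k3) (h4 : j4 ≤ k4)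
    (g0 : k0 < p) (g1 : k1 < p) (g2 : k2 < p) (g3 : k3 < p) (g4 : k4 < p) :
    ¬ p ∣ Nat.choose (k0 + k1 * p + k2 * p ^ 2 + k3 * p ^ 3 + k4 * p ^ 4)
      (j0 + j1 * p + j2 * p ^ 2 + j3 * p ^ 3 + j4 * p ^ 4) := by
  have e : ¬ p ∣ Nat.choose 0 0 := by
    simp only [Nat.choose_self, Nat.dvd_one]; exact hp.one_lt.ne'
  have := aux_lucas hp (aux_lucas hp (aux_lucas hp (aux_lucas hp (aux_lucas hp e h4 g4) h3 g3) h2 g2) h1 g1) h0 g0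
  convert this using 3 <;> ring

lemma aux_sum {F : Type*} [Field F] [Fintype F] (n : ℕ) (hn : 0 < n) :
    ∑ x : F, x ^ n = if Fintype.card F - 1 ∣ n then -1 else 0 := by
  classical
  rw [← FiniteField.sum_pow_units F n]
  rw [← Fintype.sum_subset (s := univ.filter (fun x : F => x ≠ 0))]
  · refine (Finset.sum_bij' (fun (u : Fˣ) _ => (u : F)) (fun x hx => Units.mk0 x (by simpa using hx)) ?_ ?_ ?_ ?_ ?_).symm <;> simp
  · intro x hx
    simp only [mem_filter, mem_univ, true_and]
    rintro rfl
    exact hx (zero_pow hn.ne')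

lemma aux_hermite {p : ℕ} (hp : p.Prime) 
    {F : Type*} [Field F] [Fintype F] (hF : Fintype.card F = p ^ 6)
    (a : F) (ha : a ≠ 0) (r : ℕ) (hr : 1 ≤ r)
    (ℓ : ℕ) (hℓ : ℓ = p ^ 5 + p ^ 4 + p ^ 3 + p ^ 2 + p + 1)
    (hf : Function.Bijective (fun x : F => x ^ r * (x ^ (p - 1) + a)))
    (s : ℕ) (hs : 0 < s) (hk : (p - 1) * s < p ^ 5) (j : ℕ) (hj : j ≤ (p - 1) * s)
    (hd : ℓ ∣ r * s + j) : p ∣ Nat.choose ((p - 1) * s) j := by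
  haveI := Fact.mk hp
  haveI : CharP F p := charP_of_card_eq_prime_pow hF
  have hp2 := hp.two_le
  have hcard : Fintype.card F - 1 = (p - 1) * ℓ := by
    rw [hF, hℓ]
    obtain ⟨q, rfl⟩ : ∃ q, p = q + 1 := ⟨p - 1, by omega⟩
    rw [Nat.add_sub_cancel, Nat.sub_eq_iff_eq_add (Nat.one_le_pow _ _ (by omega))]
    ring
  set k := (p - 1) * s with hkdef
  have hk0 : 0 < k := Nat.mul_pos (by omega) hs
  have hkl : k < ℓ := by rw [hℓ]; omega
  have h1 : ∑ x : F, (x ^ r * (x ^ (p - 1) + a)) ^ k = 0 := by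
    rw [hf.sum_comp (fun x : F => x ^ k)]
    apply FiniteField.sum_pow_lt_card_sub_one
    rw [hcard]
    exact lt_of_lt_of_le hkl (Nat.le_mul_of_pos_left _ (by omega))
  have h2 : ∀ x : F, (x ^ r * (x ^ (p - 1) + a)) ^ k =
      ∑ i ∈ range (k + 1), (a ^ (k - i) * (Nat.choose k i : F)) * x ^ ((p - 1) * (r * s + i)) := by
    intro x
    rw [mul_pow, add_pow, Finset.mul_sum]
    refine Finset.sum_congr rfl fun i _ => ?_
    have : (p - 1) * (r * s + i) = r * k + (p - 1) * i := by rw [hkdef]; ring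
    rw [this, pow_add, pow_mul, pow_mul]
    ring
  simp_rw [h2] at h1
  rw [Finset.sum_comm] at h1
  simp_rw [← Finset.mul_sum] at h1
  rw [Finset.sum_eq_single j] at h1
  · rw [aux_sum _ (Nat.mul_pos (by omega) (by positivity)), hcard, if_pos (Nat.mul_dvd_mul_left _ hd)] at h1
    have h3 : (Nat.choose k j : F) = 0 := by
      simpa [ha] using h1
    exact (CharP.cast_eq_zero_iff F p _).1 h3
  · intro i hi hij
    rw [aux_sum _ (Nat.mul_pos (by omega) (by positivity)), hcard, if_neg, mul_zero]
    intro h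
    have h4 := Nat.dvd_of_mul_dvd_mul_left (by omega) h
    have hi' : i ≤ k := by simpa [Nat.lt_succ_iff] using hi
    have h5 : r * s + i ≡ r * s + j [MOD ℓ] := 
      (Nat.modEq_zero_iff_dvd.2 h4).trans (Nat.modEq_zero_iff_dvd.2 hd).symm
    have h6 := Nat.ModEq.add_left_cancel' _ h5
    exact hij (Nat.ModEq.eq_of_lt_of_lt h6 (by omega) (by omega))
  · intro h
    exact absurd (Finset.mem_range.2 (by omega)) h

/-- the digit property -/
def aux_P (p : ℕ) (ρ : ℤ) : Prop :=
  ∀ s k0 k1 k2 k3 k4 j0 j1 j2 j3 j4 : ℤ, 0 < s → 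
    0 ≤ j0 → 0 ≤ j1 → 0 ≤ j2 → 0 ≤ j3 → 0 ≤ j4 →
    j0 ≤ k0 → j1 ≤ k1 → j2 ≤ k2 → j3 ≤ k3 → j4 ≤ k4 →
    k0 < p → k1 < p → k2 < p → k3 < p → k4 < p →
    ((p : ℤ) - 1) * s = k0 + k1 * p + k2 * p ^ 2 + k3 * p ^ 3 + k4 * p ^ 4 →
    ¬ ((p : ℤ) ^ 5 + p ^ 4 + p ^ 3 + p ^ 2 + p + 1) ∣
       ρ * s + (j0 + j1 * p + j2 * p ^ 2 + j3 * p ^ 3 + j4 * p ^ 4)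

lemma aux_P_of_bij {p : ℕ} (hp : p.Prime) 
    {F : Type*} [Field F] [Fintype F] (hF : Fintype.card F = p ^ 6)
    (a : F) (ha : a ≠ 0) (r : ℕ) (hr : 1 ≤ r)
    (hf : Function.Bijective (fun x : F => x ^ r * (x ^ (p - 1) + a))) : aux_P p r := by
  intro s k0 k1 k2 k3 k4 j0 j1 j2 j3 j4 hs a0 a1 a2 a3 a4 b0 b1 b2 b3 b4 c0 c1 c2 c3 c4 hk hd
  lift s to ℕ using hs.le
  lift k0 to ℕ using a0.trans b0
  lift k1 to ℕ using a1.trans b1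
  lift k2 to ℕ using a2.trans b2
  lift k3 to ℕ using a3.trans b3
  lift k4 to ℕ using a4.trans b4
  lift j0 to ℕ using a0
  lift j1 to ℕ using a1
  lift j2 to ℕ using a2
  lift j3 to ℕ using a3
  lift j4 to ℕ using a4
  have hp1 := hp.one_lt
  have hk' : (p - 1) * s = k0 + k1 * p + k2 * p ^ 2 + k3 * p ^ 3 + k4 * p ^ 4 := by
    zify [hp1.le]; exact hk
  norm_cast at *
  refine aux_lucas5 hp b0 b1 b2 b3 b4 c0 c1 c2 c3 c4 ?_
  rw [← hk']
  refine aux_hermite hp hF a ha r hr _ rfl hf s hs ?_ _ ?_ hd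
  · rw [hk']
    obtain ⟨q, rfl⟩ : ∃ q, p = q + 1 := ⟨p - 1, by omega⟩
    calc _ ≤ q + q * (q+1) + q * (q+1)^2 + q * (q+1)^3 + q * (q+1)^4 := by
            gcongr <;> omega
      _ < _ := by
        have : (q+1)^5 = q + q * (q+1) + q * (q+1)^2 + q * (q+1)^3 + q * (q+1)^4 + 1 := by ring
        omega
  · rw [hk']
    gcongr

lemma aux_P_congr {p : ℕ} {ρ ρ' : ℤ} (h : aux_P p ρ)
    (hd : ((p : ℤ) ^ 5 + p ^ 4 + p ^ 3 + p ^ 2 + p + 1) ∣ ρ - ρ') : aux_P p ρ' := by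
  intro s k0 k1 k2 k3 k4 j0 j1 j2 j3 j4 hs a0 a1 a2 a3 a4 b0 b1 b2 b3 b4 c0 c1 c2 c3 c4 hk h2
  refine h s k0 k1 k2 k3 k4 j0 j1 j2 j3 j4 hs a0 a1 a2 a3 a4 b0 b1 b2 b3 b4 c0 c1 c2 c3 c4 hk ?_
  have h3 := dvd_add (hd.mul_right s) h2
  have e : ρ * s + (j0 + j1 * p + j2 * p ^ 2 + j3 * p ^ 3 + j4 * p ^ 4) =
      (ρ - ρ') * s + (ρ' * s + (j0 + j1 * p + j2 * p ^ 2 + j3 * p ^ 3 + j4 * p ^ 4)) := by ring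
  rw [e]; exact h3

lemma aux_P_symm {p : ℕ} {ρ : ℤ} (h : aux_P p ρ) : aux_P p (1 - p - ρ) := by
  intro s k0 k1 k2 k3 k4 j0 j1 j2 j3 j4 hs a0 a1 a2 a3 a4 b0 b1 b2 b3 b4 c0 c1 c2 c3 c4 hk h2
  refine h s k0 k1 k2 k3 k4 (k0 - j0) (k1 - j1) (k2 - j2) (k3 - j3) (k4 - j4) hs
    (by omega) (by omega) (by omega) (by omega) (by omega)
    (by omega) (by omega) (by omega) (by omega) (by omega) c0 c1 c2 c3 c4 hk ?_
  have h3 := (dvd_neg).2 h2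
  have e : ρ * s + ((k0 - j0) + (k1 - j1) * p + (k2 - j2) * p ^ 2 + (k3 - j3) * p ^ 3 + (k4 - j4) * p ^ 4) =
      -((1 - p - ρ) * s + (j0 + j1 * p + j2 * p ^ 2 + j3 * p ^ 3 + j4 * p ^ 4)) := by
    linear_combination (-1 : ℤ) * hk
  rw [e]; exact h3

lemma aux_killA {p : ℕ} (y u : ℤ) (hp : 3 ≤ p) (hy1 : 1 ≤ y) (hy2 : 2 * y + 1 ≤ p)
    (hu0 : 0 ≤ u) (hup : u ≤ p) (huy : u < y ∨ (y < u ∧ (2 ≤ y ∨ u = p))) :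
    ¬ aux_P p (1 + y * p + (2 * y - u) * (p ^ 2 + p ^ 3) + y * p ^ 4) := by
  intro H
  have hs : (0 : ℤ) < 1 + 2 * p + p ^ 3 + p ^ 4 := by positivity
  rcases huy with h | ⟨h, h'⟩
  · rcases le_or_gt y (2 * u) with h3 | h3
    · refine H (1 + 2 * p + p ^ 3 + p ^ 4) (p - 1) (p - 2) 1 (p - 1) (p - 1)
        (y + u) (y - 1) 1 (2 * u - y) (p + u - y) hs ?_ ?_ ?_ ?_ ?_ ?_ ?_ ?_ ?_ ?_ ?_ ?_ ?_ ?_ ?_ ?_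
        ⟨(1 - p - p ^ 2) * u + (1 + p + 2 * p ^ 2 + p ^ 3) * y + 1, ?_⟩
      all_goals first | omega | ring
    · refine H (1 + 2 * p + p ^ 3 + p ^ 4) (p - 1) (p - 2) 1 (p - 1) (p - 1)
        (y + u) (y - 1) 1 (2 * u - y + p) (p + u - y - 1) hs ?_ ?_ ?_ ?_ ?_ ?_ ?_ ?_ ?_ ?_ ?_ ?_ ?_ ?_ ?_ ?_
        ⟨(1 - p - p ^ 2) * u + (1 + p + 2 * p ^ 2 + p ^ 3) * y + 1, ?_⟩
      all_goals first | omega | ring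
  · rcases lt_or_ge (y + u - 1) p with h3 | h3 <;> rcases lt_or_ge (2 * u - y - 1) p with h4 | h4
    · refine H (1 + 2 * p + p ^ 3 + p ^ 4) (p - 1) (p - 2) 1 (p - 1) (p - 1)
        (y + u - 1) (y - 2) 0 (2 * u - y - 1) (u - y - 1) hs ?_ ?_ ?_ ?_ ?_ ?_ ?_ ?_ ?_ ?_ ?_ ?_ ?_ ?_ ?_ ?_
        ⟨(1 - p - p ^ 2) * u + (1 + p + 2 * p ^ 2 + p ^ 3) * y, ?_⟩
      all_goals first | omega | ring
    · refine H (1 + 2 * p + p ^ 3 + p ^ 4) (p - 1) (p - 2) 1 (p - 1) (p - 1)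
        (y + u - 1) (y - 2) 0 (2 * u - y - 1 - p) (u - y) hs ?_ ?_ ?_ ?_ ?_ ?_ ?_ ?_ ?_ ?_ ?_ ?_ ?_ ?_ ?_ ?_
        ⟨(1 - p - p ^ 2) * u + (1 + p + 2 * p ^ 2 + p ^ 3) * y, ?_⟩
      all_goals first | omega | ring
    · refine H (1 + 2 * p + p ^ 3 + p ^ 4) (p - 1) (p - 2) 1 (p - 1) (p - 1)
        (y + u - 1 - p) (y - 1) 0 (2 * u - y - 1) (u - y - 1) hs ?_ ?_ ?_ ?_ ?_ ?_ ?_ ?_ ?_ ?_ ?_ ?_ ?_ ?_ ?_ ?_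
        ⟨(1 - p - p ^ 2) * u + (1 + p + 2 * p ^ 2 + p ^ 3) * y, ?_⟩
      all_goals first | omega | ring
    · refine H (1 + 2 * p + p ^ 3 + p ^ 4) (p - 1) (p - 2) 1 (p - 1) (p - 1)
        (y + u - 1 - p) (y - 1) 0 (2 * u - y - 1 - p) (u - y) hs ?_ ?_ ?_ ?_ ?_ ?_ ?_ ?_ ?_ ?_ ?_ ?_ ?_ ?_ ?_ ?_
        ⟨(1 - p - p ^ 2) * u + (1 + p + 2 * p ^ 2 + p ^ 3) * y, ?_⟩
      all_goals first | omega | ring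

lemma aux_killB {p : ℕ} (y : ℤ) (hp : 5 ≤ p) (hpr : p.Prime) (hy1 : 1 ≤ y) (hy2 : 2 * y + 1 ≤ p) :
    ¬ aux_P p (1 + y * p + (2 * y - y) * (p ^ 2 + p ^ 3) + y * p ^ 4) := by
  intro H
  have hs : (0 : ℤ) < p ^ 4 - 2 := by
    have h5 : (5 : ℤ) ≤ p := by exact_mod_cast hp
    have : (5 : ℤ) ^ 4 ≤ p ^ 4 := by gcongr
    linarith
  have h3p : 3 * y ≠ p := by
    intro h
    have : (3 : ℕ) ∣ p := by zify; exact ⟨y, h.symm⟩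
    have := (Nat.prime_dvd_prime_iff_eq Nat.prime_three hpr).1 this
    omega
  rcases lt_or_ge (3 * y) p with h | h
  · refine H (p ^ 4 - 2) 2 (p - 2) (p - 1) (p - 1) (p - 2)
        2 (2 * y) (2 * y) (3 * y) (3 * y - 1) hs ?_ ?_ ?_ ?_ ?_ ?_ ?_ ?_ ?_ ?_ ?_ ?_ ?_ ?_ ?_ ?_
        ⟨p ^ 3 * y, ?_⟩
    all_goals first | omega | ring
  · refine H (p ^ 4 - 2) 2 (p - 2) (p - 1) (p - 1) (p - 2)
        1 (2 * y - 1) (2 * y - 1) (3 * y - 1 - p) (3 * y - 1 - p) hs ?_ ?_ ?_ ?_ ?_ ?_ ?_ ?_ ?_ ?_ ?_ ?_ ?_ ?_ ?_ ?_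
        ⟨p ^ 3 * y - 1, ?_⟩
    all_goals first | omega | ring

lemma aux_killC {p : ℕ} (u : ℤ) (hp : 3 ≤ p) (hodd : Odd p) (h7 : u = 2 ∨ (4 ≤ u ∧ 7 ≤ p)) (hup : u ≤ p) :
    ¬ aux_P p (1 + 1 * p + (2 * 1 - u) * (p ^ 2 + p ^ 3) + 1 * p ^ 4) := by
  intro H
  have hs : (0 : ℤ) < 1 - p + p ^ 3 + p ^ 4 := by
    have h5 : (1 : ℤ) ≤ p := by exact_mod_cast (by omega : 1 ≤ p)
    have : (p : ℤ) ^ 1 ≤ p ^ 3 := pow_le_pow_right₀ h5 (by norm_num)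
    have : (0 : ℤ) ≤ p ^ 4 := by positivity
    linarith
  rcases h7 with rfl | ⟨h, h7⟩
  · refine H (1 - p + p ^ 3 + p ^ 4) (p - 1) 1 (p - 1) (p - 2) (p - 1)
        0 0 1 0 (p - 2) hs ?_ ?_ ?_ ?_ ?_ ?_ ?_ ?_ ?_ ?_ ?_ ?_ ?_ ?_ ?_ ?_
        ⟨1 - p + p ^ 3, ?_⟩
    all_goals first | omega | ring
  obtain ⟨n, hn⟩ := hodd
  rcases lt_or_ge (p + 1 : ℤ) (2 * u) with h3 | h3
  · refine H (1 - p + p ^ 3 + p ^ 4) (p - 1) 1 (p - 1) (p - 2) (p - 1)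
        (u - 1) 1 2 (p + 3 - u) (2 * p + 2 - 2 * u) hs ?_ ?_ ?_ ?_ ?_ ?_ ?_ ?_ ?_ ?_ ?_ ?_ ?_ ?_ ?_ ?_
        ⟨(1 - p - p ^ 2) * u + p + 2 * p ^ 2 + p ^ 3, ?_⟩
    all_goals first | omega | ring
  · refine H (1 - p + p ^ 3 + p ^ 4) (p - 1) 1 (p - 1) (p - 2) (p - 1)
        (u - 2) 0 1 (p + 2 - u) (p + 1 - 2 * u) hs ?_ ?_ ?_ ?_ ?_ ?_ ?_ ?_ ?_ ?_ ?_ ?_ ?_ ?_ ?_ ?_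
        ⟨(1 - p - p ^ 2) * u - 1 + p + 2 * p ^ 2 + p ^ 3, ?_⟩
    all_goals first | omega | ring

lemma aux_killD {p : ℕ} (hp : 7 ≤ p) :
    ¬ aux_P p (1 + 1 * p + (2 * 1 - 3) * (p ^ 2 + p ^ 3) + 1 * p ^ 4) := by
  intro H
  have hs : (0 : ℤ) < 2 + 2 * p + p ^ 3 + p ^ 4 := by positivity
  refine H (2 + 2 * p + p ^ 3 + p ^ 4) (p - 2) (p - 1) 1 (p - 1) (p - 1)
        2 (p - 2) 0 5 0 hs ?_ ?_ ?_ ?_ ?_ ?_ ?_ ?_ ?_ ?_ ?_ ?_ ?_ ?_ ?_ ?_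
        ⟨4 - 2 * p - p ^ 2 + p ^ 3, ?_⟩
  all_goals first | omega | ring

lemma aux_kill {p : ℕ} (y u : ℤ) (hpr : p.Prime) (hodd : Odd p) (hp : 3 ≤ p) (hy1 : 1 ≤ y) (hy2 : 2 * y + 1 ≤ p)
    (hu0 : 0 ≤ u) (hup : u ≤ p) :
    ¬ aux_P p (1 + y * p + (2 * y - u) * (p ^ 2 + p ^ 3) + y * p ^ 4) := by
  by_cases hA : u < y ∨ (y < u ∧ (2 ≤ y ∨ u = p))
  · exact aux_killA y u hp hy1 hy2 hu0 hup hA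
  rcases eq_or_ne u y with rfl | huy
  · by_cases h5 : 5 ≤ p
    · exact aux_killB u h5 hpr hy1 hy2
    · obtain rfl : p = 3 := by obtain ⟨n, hn⟩ := hodd; omega
      obtain rfl : u = 1 := by omega
      intro H
      refine H 80 1 2 2 2 1 1 1 1 2 1 ?_ ?_ ?_ ?_ ?_ ?_ ?_ ?_ ?_ ?_ ?_ ?_ ?_ ?_ ?_ ?_ ?_ ?_ <;> norm_num
  obtain rfl : y = 1 := by omega
  by_cases h5 : 7 ≤ p
  · rcases eq_or_ne u 3 with rfl | h3
    · exact aux_killD h5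
    · exact aux_killC u hp hodd (by omega) hup
  · rcases eq_or_ne u 2 with rfl | h2
    · exact aux_killC 2 hp hodd (by omega) hup
    obtain rfl : p = 5 := by obtain ⟨n, hn⟩ := hodd; omega
    have : u = 3 ∨ u = 4 := by omega
    intro H
    rcases this with rfl | rfl
    · refine H 762 3 4 1 4 4 2 3 0 0 1 ?_ ?_ ?_ ?_ ?_ ?_ ?_ ?_ ?_ ?_ ?_ ?_ ?_ ?_ ?_ ?_ ?_ ?_ <;> norm_num
    · refine H 762 3 4 1 4 4 3 3 1 3 2 ?_ ?_ ?_ ?_ ?_ ?_ ?_ ?_ ?_ ?_ ?_ ?_ ?_ ?_ ?_ ?_ ?_ ?_ <;> norm_num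

lemma aux_digit (p : ℤ) (hp : 0 < p) (e M : ℤ) (he : 0 ≤ e) (h : e < p * M) :
    ∃ d e', e = d + p * e' ∧ 0 ≤ d ∧ d ≤ p - 1 ∧ 0 ≤ e' ∧ e' < M := by
  refine ⟨e % p, e / p, (Int.emod_add_mul_ediv e p).symm, Int.emod_nonneg _ hp.ne',
    Int.le_sub_one_of_lt (Int.emod_lt_of_pos _ hp), Int.ediv_nonneg he hp.le, ?_⟩
  exact Int.ediv_lt_of_lt_mul hp (by linarith)

lemma aux_main {p r : ℕ} (hpr : p.Prime) (hodd : Odd p) (H0 : aux_P p r) :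
    ((p : ℤ) ^ 5 + p ^ 4 + p ^ 3 + p ^ 2 + p + 1) ∣ (r : ℤ) - 1 ∨
    ((p : ℤ) ^ 5 + p ^ 4 + p ^ 3 + p ^ 2 + p + 1) ∣ (r : ℤ) + p := by
  have hp3 : 3 ≤ p := by
    have := hpr.two_le
    obtain ⟨n, hn⟩ := hodd; omega
  have hq3 : (3 : ℤ) ≤ p := by exact_mod_cast hp3
  obtain ⟨q, hq⟩ : ∃ q : ℤ, q = p := ⟨_, rfl⟩
  rw [← hq] at hq3 ⊢
  have hq0 : 0 < q := by linarith
  -- step 1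
  obtain ⟨U, hU0, hU1, hU⟩ : ∃ U : ℤ, 0 ≤ U ∧ U ≤ q ^ 4 + q ^ 3 + q ^ 2 + q ∧
      (q ^ 5 + q ^ 4 + q ^ 3 + q ^ 2 + q + 1) ∣ (r : ℤ) - (1 + q * U) := by
    obtain ⟨L, hLdef⟩ : ∃ L, L = q ^ 5 + q ^ 4 + q ^ 3 + q ^ 2 + q + 1 := ⟨_, rfl⟩
    have hL : 0 < L := by rw [hLdef]; positivity
    have he0 := Int.emod_nonneg (q ^ 5 * r) hL.ne'
    have he1 := Int.emod_lt_of_pos (q ^ 5 * r) hL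
    obtain ⟨c, hc⟩ : L ∣ q ^ 5 * r - (q ^ 5 * r) % L := Int.dvd_self_sub_emod
    generalize (q ^ 5 * (r : ℤ)) % L = e at he0 he1 hc
    have h5 : q ^ 5 ≤ e := by
      by_contra! hlt
      obtain ⟨d0, e1, he1, a0, b0, f1, g1⟩ := aux_digit q hq0 e (q ^ 4) he0 (by linarith [show q * q ^ 4 = q ^ 5 by ring])
      obtain ⟨d1, e2, he2, a1, b1, f2, g2⟩ := aux_digit q hq0 e1 (q ^ 3) f1 (by linarith [show q * q ^ 3 = q ^ 4 by ring])
      obtain ⟨d2, e3, he3, a2, b2, f3, g3⟩ := aux_digit q hq0 e2 (q ^ 2) f2 (by linarith [show q * q ^ 2 = q ^ 3 by ring])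
      obtain ⟨d3, d4, he4, a3, b3, a4, b4⟩ := aux_digit q hq0 e3 q f3 (by linarith [show q * q = q ^ 2 by ring])
      rw [hq] at *
      refine H0 (1 + p + p ^ 2 + p ^ 3 + p ^ 4) (p - 1) (p - 1) (p - 1) (p - 1) (p - 1)
        d0 d1 d2 d3 d4 (by positivity) a0 a1 a2 a3 a4 b0 b1 b2 b3 (by omega) (by omega) (by omega) (by omega) (by omega) (by omega) 
        (by ring) ⟨r - c, ?_⟩
      have : e = d0 + d1 * p + d2 * p ^ 2 + d3 * p ^ 3 + d4 * p ^ 4 := by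
        rw [he1, he2, he3, he4]; ring
      rw [← this]
      linear_combination (-1 : ℤ) * hc - c * hLdef
    refine ⟨e - q ^ 5, by linarith, by linarith, ⟨q * c - (q - 1) * (r - 1), ?_⟩⟩
    linear_combination q * hc + q * c * hLdef
  -- step 2
  have H1 : aux_P p (1 + q * U) := aux_P_congr H0 (by rw [← hq]; exact hU)
  have h2 : q + 1 ∣ U := by
    have hL : 0 < q + 1 := by positivity
    have he0 := Int.emod_nonneg (-(1 + q * U)) hL.ne'
    have he1 := Int.emod_lt_of_pos (-(1 + q * U)) hL
    obtain ⟨c, hc⟩ : q + 1 ∣ -(1 + q * U) - (-(1 + q * U)) % (q + 1) := Int.dvd_self_sub_emod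
    set x := (-(1 + q * U)) % (q + 1)
    have h5 : x = q := by
      by_contra! hne
      have hlt : x ≤ q - 1 := by omega
      rw [hq] at *
      refine H1 (1 + p ^ 2 + p ^ 4) (p - 1) 0 (p - 1) 0 (p - 1)
        x 0 x 0 x (by positivity) he0 le_rfl he0 le_rfl he0 hlt le_rfl hlt le_rfl hlt (by omega) (by omega) (by omega) (by omega) (by omega)
        (by ring) ⟨-c, ?_⟩
      linear_combination (-1 - (p : ℤ) ^ 2 - p ^ 4) * hc
    rw [h5] at hc
    exact ⟨1 + U + c, by linear_combination (1 : ℤ) * hc⟩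
  -- step 3
  obtain ⟨u, hu0, hup, hu⟩ : ∃ u : ℤ, 0 ≤ u ∧ u ≤ q ∧ q ^ 2 + q + 1 ∣ u - U := by
    have hL : 0 < q ^ 2 + q + 1 := by positivity
    have he0 := Int.emod_nonneg (-((1 + q) * (1 + q * U))) hL.ne'
    have he1 := Int.emod_lt_of_pos (-((1 + q) * (1 + q * U))) hL
    obtain ⟨c, hc⟩ : q ^ 2 + q + 1 ∣ -((1 + q) * (1 + q * U)) - (-((1 + q) * (1 + q * U))) % (q ^ 2 + q + 1) := Int.dvd_self_sub_emod
    set m := (-((1 + q) * (1 + q * U))) % (q ^ 2 + q + 1)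
    have h5 : q ^ 2 ≤ m := by
      by_contra! hlt
      obtain ⟨d0, d1, he1, a0, b0, a1, b1⟩ := aux_digit q hq0 m q he0 (by linarith [show q * q = q ^ 2 by ring])
      rw [hq] at *
      refine H1 ((1 + p) * (1 + p ^ 3)) (p - 1) (p - 1) 0 (p - 1) (p - 1)
        d0 d1 0 d0 d1 (by positivity) a0 a1 le_rfl a0 a1 b0 (by omega) le_rfl b0 (by omega) (by omega) (by omega) (by omega) (by omega) (by omega)
        (by ring) ⟨-c, ?_⟩
      linear_combination (-1 - (p : ℤ) ^ 3) * hc - (1 + (p : ℤ) ^ 3) * he1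
    refine ⟨m - q ^ 2, by linarith, by linarith, ⟨-c - 1 - U, ?_⟩⟩
    linear_combination (-1 : ℤ) * hc
  -- step 4
  obtain ⟨V, rfl⟩ := h2
  obtain ⟨c, hc⟩ := hu
  obtain ⟨y, hy⟩ : ∃ y, V + q * u = (q ^ 2 + q + 1) * y := ⟨V + q * c, by linear_combination q * hc⟩
  have hV0 : 0 ≤ V := by
    by_contra! h
    nlinarith
  have hV1 : V ≤ q ^ 3 + q := by
    by_contra! h
    nlinarith
  have hN : 0 < q ^ 2 + q + 1 := by positivity
  have hqu : 0 ≤ q * u := by positivity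
  have hquq : q * u ≤ q * q := by gcongr
  have hy0 : 0 ≤ y := by
    by_contra! h
    nlinarith
  have hyp : y ≤ q := by
    by_contra! h
    have : (q ^ 2 + q + 1) * (q + 1) ≤ (q ^ 2 + q + 1) * y := by gcongr; omega
    nlinarith
  obtain ⟨w, hw⟩ := hU
  rcases eq_or_lt_of_le hy0 with h0 | hy1
  · left
    rw [← h0] at hy
    have hV : V = 0 := by linarith
    exact ⟨w, by rw [← hw, hV]; ring⟩
  rcases eq_or_lt_of_le hyp with h0 | hyq
  · right
    have hV : V = q ^ 3 + q := by
      rw [h0] at hy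
      nlinarith
    exact ⟨w + 1, by rw [hV] at hw; linear_combination hw⟩
  exfalso
  have H2 : aux_P p (1 + y * p + (2 * y - u) * (p ^ 2 + p ^ 3) + y * p ^ 4) := by
    convert H1 using 1
    rw [← hq]
    linear_combination (-1 : ℤ) * q * (q + 1) * hy
  rw [hq] at *
  by_cases hh : 2 * y + 1 ≤ p
  · exact aux_kill y u hpr hodd hp3 (by omega) hh hu0 hup H2
  · refine aux_kill (p - y) (p - u) hpr hodd hp3 (by omega) (by obtain ⟨n, hn⟩ := hodd; omega) (by omega) (by omega) 
      (aux_P_congr (aux_P_symm H2) ⟨-1, ?_⟩)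
    ring

lemma aux_card {p : ℕ} (hp : p.Prime) : p ^ 6 - 1 = (p - 1) * (p ^ 5 + p ^ 4 + p ^ 3 + p ^ 2 + p + 1) := by
  have := hp.two_le
  obtain ⟨q, rfl⟩ : ∃ q, p = q + 1 := ⟨p - 1, by omega⟩
  rw [Nat.add_sub_cancel, Nat.sub_eq_iff_eq_add (Nat.one_le_pow _ _ (by omega))]
  ring

lemma aux_gen {F : Type*} [Field F] [Fintype F] : ∃ g : F, g ≠ 0 ∧ (∀ x : F, x ≠ 0 → ∃ n : ℕ, g ^ n = x) ∧
    ∀ n : ℕ, g ^ n = 1 → Fintype.card F - 1 ∣ n := by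
  obtain ⟨g, hg⟩ := IsCyclic.exists_generator (α := Fˣ)
  refine ⟨g, g.ne_zero, ?_, ?_⟩
  · intro x hx
    obtain ⟨n, hn⟩ := (mem_powers_iff_mem_zpowers).2 (hg (Units.mk0 x hx))
    exact ⟨n, by simpa using congrArg Units.val hn⟩
  · intro n hn
    rw [← Nat.card_eq_fintype_card, ← Nat.card_units, ← orderOf_eq_card_of_forall_mem_zpowers hg]
    apply orderOf_dvd_of_pow_eq_one
    ext; simpa using hn

section
variable {p : ℕ} {F : Type*} [Field F] [Fintype F] {a : F} {r : ℕ}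

lemma aux_nec1 (hp : p.Prime) (hF : Fintype.card F = p ^ 6) (ha : a ≠ 0) (hr : 1 ≤ r)
    (hf : Function.Bijective (fun x : F => x ^ r * (x ^ (p - 1) + a))) :
    (-a) ^ (p ^ 5 + p ^ 4 + p ^ 3 + p ^ 2 + p + 1) ≠ 1 := by
  intro h
  obtain ⟨g, hg0, hg1, hg2⟩ := aux_gen (F := F)
  obtain ⟨n, hn⟩ := hg1 (-a) (neg_ne_zero.2 ha)
  rw [← hn, ← pow_mul] at h
  have h1 := hg2 _ h
  rw [hF, aux_card hp] at h1
  obtain ⟨m, rfl⟩ := Nat.dvd_of_mul_dvd_mul_right (by positivity) h1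
  have h2 : g ^ m = 0 := by
    apply hf.1
    simp only
    rw [← pow_mul, ← pow_mul, mul_comm m (p - 1), hn, zero_pow (by omega)]
    simp
  exact pow_ne_zero _ hg0 h2

lemma aux_nec2 (hp : p.Prime) (hF : Fintype.card F = p ^ 6)
    (hf : Function.Bijective (fun x : F => x ^ r * (x ^ (p - 1) + a))) :
    Nat.gcd r (p - 1) = 1 := by
  obtain ⟨g, hg0, hg1, hg2⟩ := aux_gen (F := F)
  have hp2 := hp.two_le
  have hcard := aux_card hp
  set ℓ := p ^ 5 + p ^ 4 + p ^ 3 + p ^ 2 + p + 1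
  have hl : 0 < ℓ := by positivity
  obtain ⟨r', hr'⟩ := Nat.gcd_dvd_left r (p - 1)
  obtain ⟨m, hm⟩ := Nat.gcd_dvd_right r (p - 1)
  set d := Nat.gcd r (p - 1)
  have hfull : g ^ ((p - 1) * ℓ) = 1 := by
    rw [← hcard, ← hF]; exact FiniteField.pow_card_sub_one_eq_one g hg0
  have hzd : (g ^ (m * ℓ)) ^ d = 1 := by
    rw [← pow_mul, ← hfull, hm]; congr 1; ring
  have h1 : g ^ (m * ℓ) = 1 := by
    apply hf.1
    simp only
    rw [hr', hm, pow_mul, pow_mul _ d m, hzd]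
    simp
  have h2 := hg2 _ h1
  rw [hF, hcard] at h2
  have h3 := Nat.dvd_of_mul_dvd_mul_right hl h2
  have hm0 : 0 < m := by
    rcases Nat.eq_zero_or_pos m with h | h
    · rw [h] at hm; omega
    · exact h
  have h4 := Nat.le_of_dvd hm0 h3
  have hd0 : 0 < d := by
    rcases Nat.eq_zero_or_pos d with h | h
    · rw [h] at hm; omega
    · exact h
  nlinarith

lemma aux_lin (hp : p.Prime) [CharP F p] (b : F) (hb : ∀ x : F, x ≠ 0 → x ^ (p - 1) + b ≠ 0) {x y : F}
    (hxy : x ^ p + b * x = y ^ p + b * y) : x = y := by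
  have := Fact.mk hp
  by_contra hne
  have h0 : x - y ≠ 0 := sub_ne_zero.2 hne
  apply hb _ h0
  have h1 : (x - y) ^ p = x ^ p - y ^ p := sub_pow_char x y
  have h2 : (x - y) ^ p = (x - y) ^ (p - 1) * (x - y) := by
    rw [← pow_succ, Nat.sub_add_cancel hp.one_lt.le]
  apply mul_right_cancel₀ h0
  rw [zero_mul, add_mul, ← h2, h1]
  linear_combination hxy

/-- if the `(p-1)`-th powers of two values of a linearized binomial agree, the arguments are proportional -/
lemma aux_lin2 (hp : p.Prime) [CharP F p] (b : F) (hb : ∀ x : F, x ≠ 0 → x ^ (p - 1) + b ≠ 0) {x y : F}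
    (hx : x ≠ 0) (hy : y ≠ 0)
    (hxy : (x ^ p + b * x) ^ (p - 1) = (y ^ p + b * y) ^ (p - 1)) : ∃ c : F, c ^ (p - 1) = 1 ∧ x = c * y := by
  have hsplit : ∀ z : F, z ^ p = z ^ (p - 1) * z := fun z => by
    rw [← pow_succ, Nat.sub_add_cancel hp.one_lt.le]
  have hy2 : y ^ p + b * y ≠ 0 := by
    rw [hsplit, ← add_mul]; exact mul_ne_zero (hb y hy) hy
  have hc : ((x ^ p + b * x) / (y ^ p + b * y)) ^ (p - 1) = 1 := by
    rw [div_pow, hxy, div_self (pow_ne_zero _ hy2)]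
  refine ⟨_, hc, ?_⟩
  apply aux_lin hp b hb
  rw [mul_pow, hsplit ((x ^ p + b * x) / (y ^ p + b * y)), hc]
  field_simp

lemma aux_suf (hp : p.Prime) (hF : Fintype.card F = p ^ 6) (ha : a ≠ 0) (hr : 1 ≤ r)
    (h1 : (-a) ^ (p ^ 5 + p ^ 4 + p ^ 3 + p ^ 2 + p + 1) ≠ 1) (h2 : Nat.gcd r (p - 1) = 1)
    (h3 : (∃ n, r = 1 + (p ^ 5 + p ^ 4 + p ^ 3 + p ^ 2 + p + 1) * n) ∨
      (∃ n, r + p = (p ^ 5 + p ^ 4 + p ^ 3 + p ^ 2 + p + 1) * n)) :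
    Function.Bijective (fun x : F => x ^ r * (x ^ (p - 1) + a)) := by
  have := Fact.mk hp
  have : CharP F p := charP_of_card_eq_prime_pow hF
  have hp2 := hp.two_le
  have hcard := aux_card hp
  set ℓ := p ^ 5 + p ^ 4 + p ^ 3 + p ^ 2 + p + 1
  have hsplit : ∀ z : F, z ^ p = z ^ (p - 1) * z := fun z => by
    rw [← pow_succ, Nat.sub_add_cancel hp.one_lt.le]
  have hone : ∀ x : F, x ≠ 0 → (x ^ ℓ) ^ (p - 1) = 1 := by
    intro x hx
    rw [← pow_mul, mul_comm, ← hcard, ← hF]; exact FiniteField.pow_card_sub_one_eq_one x hx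
  have hnz : ∀ x : F, x ≠ 0 → x ^ (p - 1) + a ≠ 0 := by
    intro x hx h
    apply h1
    rw [← eq_neg_of_add_eq_zero_left h, ← pow_mul, mul_comm, pow_mul]
    exact hone x hx
  have hnz2 : ∀ x : F, x ≠ 0 → x ^ (p - 1) + a⁻¹ ≠ 0 := by
    intro x hx h
    apply hnz x⁻¹ (inv_ne_zero hx)
    rw [inv_pow, eq_neg_of_add_eq_zero_left h]
    field_simp
    ring
  rw [← Finite.injective_iff_bijective]
  -- proportional arguments
  have key : ∀ x y c : F, y ≠ 0 → c ^ (p - 1) = 1 → x = c * y →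
      x ^ r * (x ^ (p - 1) + a) = y ^ r * (y ^ (p - 1) + a) → x = y := by
    intro x y c hy hc hx hxy
    rw [hx, mul_pow, mul_pow, hc, one_mul] at hxy
    have hcr : c ^ r = 1 := by
      apply mul_right_cancel₀ (mul_ne_zero (pow_ne_zero r hy) (hnz y hy))
      linear_combination hxy
    have : c ^ Nat.gcd r (p - 1) = 1 := pow_gcd_eq_one.2 ⟨hcr, hc⟩
    rw [h2, pow_one] at this
    rw [hx, this, one_mul]
  intro x y hxy
  simp only at hxy
  by_cases hx : x = 0
  · by_contra hy
    have hy : y ≠ 0 := by rintro rfl; exact hy hx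
    rw [hx, zero_pow (by omega), zero_mul] at hxy
    exact mul_ne_zero (pow_ne_zero r hy) (hnz y hy) hxy.symm
  by_cases hy : y = 0
  · rw [hy, zero_pow (by omega), zero_mul] at hxy
    exact absurd hxy (mul_ne_zero (pow_ne_zero r hx) (hnz x hx))
  rcases h3 with ⟨n, hn⟩ | ⟨n, hn⟩
  · have hval : ∀ z : F, z ≠ 0 → (z ^ r * (z ^ (p - 1) + a)) ^ (p - 1) = (z ^ p + a * z) ^ (p - 1) := by
      intro z hz
      have : z ^ r * (z ^ (p - 1) + a) = (z ^ ℓ) ^ n * (z ^ p + a * z) := by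
        rw [hn, pow_add, pow_mul, hsplit]; ring
      rw [this, mul_pow, ← pow_mul, mul_comm n, pow_mul, hone z hz, one_pow, one_mul]
    have h4 := congrArg (fun t => t ^ (p - 1)) hxy
    beta_reduce at h4
    rw [hval x hx, hval y hy] at h4
    obtain ⟨c, hc, hxc⟩ := aux_lin2 hp a hnz hx hy h4
    exact key x y c hy hc hxc hxy
  · have hval : ∀ z : F, z ≠ 0 → (z ^ r * (z ^ (p - 1) + a)) ^ (p - 1) =
        a ^ (p - 1) * ((z⁻¹) ^ p + a⁻¹ * z⁻¹) ^ (p - 1) := by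
      intro z hz
      have : z ^ r * (z ^ (p - 1) + a) = (z ^ ℓ) ^ n * (a * ((z⁻¹) ^ p + a⁻¹ * z⁻¹)) := by
        rw [← pow_mul, ← hn, pow_add, inv_pow, mul_assoc]
        congr 1
        rw [hsplit]
        have := pow_ne_zero (p - 1) hz
        field_simp
        ring
      rw [this, mul_pow, ← pow_mul, mul_comm n, pow_mul, hone z hz, one_pow, one_mul, mul_pow]
    have h4 := congrArg (fun t => t ^ (p - 1)) hxy
    beta_reduce at h4
    rw [hval x hx, hval y hy] at h4
    have h5 := mul_left_cancel₀ (pow_ne_zero _ ha) h4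
    obtain ⟨c, hc, hxc⟩ := aux_lin2 hp a⁻¹ hnz2 (inv_ne_zero hx) (inv_ne_zero hy) h5
    have hc0 : c ≠ 0 := by
      rintro rfl
      rw [zero_pow (by omega)] at hc
      exact zero_ne_one hc
    refine key x y c⁻¹ hy (by rw [inv_pow, hc, inv_one]) ?_ hxy
    rw [← inv_inv x, hxc, mul_inv, inv_inv]

end

theorem stmt_18 (p : ℕ) (hp : p.Prime) (hpodd : Odd p)
    {F : Type*} [Field F] [Fintype F] (hF : Fintype.card F = p ^ 6)
    (a : F) (ha : a ≠ 0) (r : ℕ) (hr : 1 ≤ r)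
    (ℓ : ℕ) (hℓ : ℓ = p ^ 5 + p ^ 4 + p ^ 3 + p ^ 2 + p + 1) :
    Function.Bijective (fun x : F => x ^ r * (x ^ (p - 1) + a)) ↔
      ((-a) ^ ℓ ≠ 1 ∧ Nat.gcd r (p - 1) = 1 ∧ (r % ℓ = 1 ∨ r % ℓ = ℓ - p)) := by
  have hp2 := hp.two_le
  have hlp : p + 2 ≤ ℓ := by
    have : 1 ≤ p ^ 5 := Nat.one_le_pow _ _ (by omega)
    omega
  constructor
  · intro hf
    refine ⟨by rw [hℓ]; exact aux_nec1 hp hF ha hr hf, aux_nec2 hp hF hf, ?_⟩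
    have hcast : ((p : ℤ) ^ 5 + p ^ 4 + p ^ 3 + p ^ 2 + p + 1) = (ℓ : ℤ) := by rw [hℓ]; push_cast; ring
    rcases aux_main hp hpodd (aux_P_of_bij hp hF a ha r hr hf) with h | h
    · left
      rw [hcast] at h
      have h1 : 1 ≡ r [MOD ℓ] := (Nat.modEq_iff_dvd' hr).2 (by zify [hr]; exact h)
      rw [← h1, Nat.mod_eq_of_lt (by omega)]
    · right
      rw [hcast] at h
      have h1 : r + p ≡ (ℓ - p) + p [MOD ℓ] := by
        rw [Nat.sub_add_cancel (by omega)]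
        exact (Nat.modEq_zero_iff_dvd.2 (by exact_mod_cast h)).trans
          (Nat.modEq_zero_iff_dvd.2 dvd_rfl).symm
      have h2 : r ≡ ℓ - p [MOD ℓ] := Nat.ModEq.add_right_cancel' _ h1
      rw [h2, Nat.mod_eq_of_lt (by omega)]
  · rintro ⟨h1, h2, h3⟩
    rw [hℓ] at h1
    refine aux_suf hp hF ha hr h1 h2 ?_
    rw [← hℓ]
    have h4 := Nat.mod_add_div r ℓ
    rcases h3 with h3 | h3
    · left; exact ⟨r / ℓ, by rw [h3] at h4; exact h4.symm⟩
    · right; exact ⟨r / ℓ + 1, by rw [h3] at h4; rw [mul_add, mul_one]; omega⟩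
end
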